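/- For every binary path P and every nonnegative integer k: if k < δ(P) then μ^k(P, 1_{|P|}) = 0, and if k = δ(P) then μ^k(P, 1_{|P|}) = (−1)^{l(P, 1_{|P|})} · f(P), where f(P) is the number of chains from P to 1_{|P|} of length δ(P) with small intervals. -/

import Mathlib

/-- A binary path is a list of steps: `true` = upstep `u`, `false` = downstep `d`. -/
abbrev BinPath := List Bool

/-- `ht P k` is the height of the `k`-th point of the path `P` (the point reached
after the first `k` steps). -/
def ht (P : BinPath) (k : ℕ) : ℤ :=
  ((P.take k).map (fun b => if b then (1 : ℤ) else -1)).sum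

/-- The lattice order on binary paths of the same length: `P ≤ Q` iff
`hᵢ(P) ≤ hᵢ(Q)` for all `i`. -/
def pathLe (P Q : BinPath) : Prop :=
  P.length = Q.length ∧ ∀ k, ht P k ≤ ht Q k

def pathLt (P Q : BinPath) : Prop := pathLe P Q ∧ P ≠ Q

/-- The maximum path `1ₙ = uⁿ`. -/
def maxPath (n : ℕ) : BinPath := List.replicate n true

/-- Step `i` (0-based) of `P` is a downstep whose endpoint is a valley, i.e. it is
followed by an upstep or it is the last step of `P`. -/
def isValley (P : BinPath) (i : ℕ) : Prop :=
  i < P.length ∧ P.getD i true = false ∧ P.getD (i + 1) true = true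

/-- The number of valleys of `P`. -/
def numValleys (P : BinPath) : ℕ :=
  ((Finset.range P.length).filter
    (fun i => P.getD i true = false ∧ P.getD (i + 1) true = true)).card

/-- The filling of `P`: every valley of `P` is turned into a peak
(each occurrence `du` whose middle point is a valley becomes `ud`, and a final
valley-`d` becomes `u`). -/
def fill (P : BinPath) : BinPath :=
  List.ofFn (fun i : Fin P.length =>
    if P.get i then P.getD (i.1 - 1) true else P.getD (i.1 + 1) true)

/-- The degree of `P`: the least `k` such that the `k`-fold iterated filling
of `P` is the maximum path. -/
noncomputable def degree (P : BinPath) : ℕ :=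
  sInf {k | fill^[k] P = maxPath P.length}

/-- `fPath P` is the number of chains from `P` to the maximum path `1_{|P|}` of
length `degree P` having small intervals. -/
noncomputable def fPath (P : BinPath) : ℕ :=
  Set.ncard {c : ℕ → BinPath |
    c 0 = P ∧ (∀ i, degree P ≤ i → c i = maxPath P.length) ∧
    ∀ i < degree P, pathLt (c i) (c (i + 1)) ∧ pathLe (c (i + 1)) (fill (c i))}

/-- Height of the lowest valley of `P`. -/
noncomputable def lv (P : BinPath) : ℤ :=
  sInf {h : ℤ | ∃ i, isValley P i ∧ ht P (i + 1) = h}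

/-- Height of the highest valley of `P`. -/
noncomputable def hv (P : BinPath) : ℤ :=
  sSup {h : ℤ | ∃ i, isValley P i ∧ ht P (i + 1) = h}

noncomputable def hvNat (P : BinPath) : ℕ := (hv P).toNat

/-- `P′`: every low valley of `P` is turned into a peak. -/
noncomputable def lowFill (P : BinPath) : BinPath :=
  List.ofFn (fun i : Fin P.length =>
    if P.get i then
      (if P.getD (i.1 - 1) true = false ∧ ht P i.1 = lv P then false else true)
    else
      (if P.getD (i.1 + 1) true = true ∧ ht P (i.1 + 1) = lv P then true else false))

/-- `P*`: every valley of `P` is turned into a peak, except the last one when `P`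
ends with a downstep. -/
def starFill (P : BinPath) : BinPath :=
  List.ofFn (fun i : Fin P.length =>
    if i.1 + 1 = P.length ∧ P.get i = false then false
    else if P.get i then P.getD (i.1 - 1) true else P.getD (i.1 + 1) true)

/-- A Dyck path: starts and ends at height 0 and lies weakly above height 0. -/
def IsDyck (P : BinPath) : Prop := ht P P.length = 0 ∧ ∀ k, 0 ≤ ht P k

/-- A Dyck prefix: a prefix of a Dyck path. -/
def IsDyckPrefix (P : BinPath) : Prop := ∃ Q : BinPath, IsDyck (P ++ Q)

/-- A Dyck suffix: a suffix of a Dyck path. -/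
def IsDyckSuffix (P : BinPath) : Prop := ∃ Q : BinPath, IsDyck (Q ++ P)

/-- The pyramid `u^m d^m`. -/
def pyramid (m : ℕ) : BinPath := List.replicate m true ++ List.replicate m false

/-- Cardinality of the interval `[P, Q]` in the lattice of binary paths. -/
noncomputable def intervalCard (P Q : BinPath) : ℕ :=
  Set.ncard {R : BinPath | pathLe P R ∧ pathLe R Q}

/-- `I(s) = |[s, u^{|s|/2} d^{|s|/2}]|`. -/
noncomputable def Ifun (s : BinPath) : ℕ := intervalCard s (pyramid (s.length / 2))

/-- `J(P) = |[P, u^{|P|}]|`. -/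
noncomputable def Jfun (P : BinPath) : ℕ := intervalCard P (maxPath P.length)

/-- `P` and `Q` have exactly the same valleys at every height at most `m`. -/
def sameValleysUpTo (P Q : BinPath) (m : ℤ) : Prop :=
  ∀ (i : ℕ) (t : ℤ), t ≤ m →
    ((isValley P i ∧ ht P (i + 1) = t) ↔ (isValley Q i ∧ ht Q (i + 1) = t))

/-- A multichain of Dyck paths of type `V` from `a` to `s`: it has length
`h = hv(a)` and for every `j ∈ [h]` its `(j-1)`-st and `j`-th members have the
same valleys at every height at most `h - j`.  (The function `σ` is frozen from
index `h` on, so that such multichains are counted correctly.) -/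
def IsVChain (a s : BinPath) (σ : ℕ → BinPath) : Prop :=
  σ 0 = a ∧ (∀ j, hvNat a ≤ j → σ j = s) ∧ (∀ j, IsDyck (σ j)) ∧
  (∀ j < hvNat a, pathLe (σ j) (σ (j + 1))) ∧
  (∀ j, 1 ≤ j → j ≤ hvNat a →
    sameValleysUpTo (σ (j - 1)) (σ j) ((hvNat a : ℤ) - (j : ℤ)))

/-- `V(a,s)`: the number of `a`–`s` multichains of type `V`. -/
noncomputable def VPath (a s : BinPath) : ℕ :=
  Set.ncard {σ : ℕ → BinPath | IsVChain a s σ}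

/-- `ζ^k(P,Q)`: the number of `P`–`Q` multichains of length `k`. -/
noncomputable def zetaPow (k : ℕ) (P Q : BinPath) : ℕ :=
  Set.ncard {c : ℕ → BinPath |
    c 0 = P ∧ (∀ i, k ≤ i → c i = Q) ∧ ∀ i < k, pathLe (c i) (c (i + 1))}

/-- The join of two paths of the same length (pointwise max of heights). -/
def pathSup (P Q : BinPath) : BinPath :=
  List.ofFn (fun i : Fin P.length =>
    decide (max (ht P i.1) (ht Q i.1) < max (ht P (i.1 + 1)) (ht Q (i.1 + 1))))

/-- The meet of two paths of the same length (pointwise min of heights). -/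
def pathInf (P Q : BinPath) : BinPath :=
  List.ofFn (fun i : Fin P.length =>
    decide (min (ht P i.1) (ht Q i.1) < min (ht P (i.1 + 1)) (ht Q (i.1 + 1))))

/-- `Q` covers `P` in the lattice of binary paths. -/
def pathCovBy (P Q : BinPath) : Prop :=
  pathLt P Q ∧ ∀ R : BinPath, pathLt P R → pathLt R Q → False

/-- `l(P,Q) = (1/2)·Σᵢ (hᵢ(Q) − hᵢ(P))`. -/
def lpq (P Q : BinPath) : ℕ :=
  ((∑ i ∈ Finset.range P.length, (ht Q (i + 1) - ht P (i + 1))) / 2).toNat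

/-- Convolution in the incidence algebra of the lattice of binary paths. -/
noncomputable def conv (F G : BinPath → BinPath → ℤ) : BinPath → BinPath → ℤ :=
  fun P Q => ∑ᶠ (R : BinPath) (_ : pathLe P R ∧ pathLe R Q), F P R * G R Q

/-- The delta function of the incidence algebra. -/
def deltaFun : BinPath → BinPath → ℤ := fun P Q => if P = Q then 1 else 0

/-- `μ^k`: the `k`-th convolution power of `μ` (`μ^0` is the delta function). -/
noncomputable def muPow (mu : BinPath → BinPath → ℤ) (k : ℕ) : BinPath → BinPath → ℤ :=
  (conv mu)^[k] deltaFun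

/-- The number of upsteps among the first `k` steps of `P`, where `P` is continued by upsteps
beyond its end. -/
def upCount (P : BinPath) (k : ℕ) : ℕ :=
  ∑ j ∈ Finset.range k, if P.getD j true then 1 else 0

theorem upCount_zero (P : BinPath) : upCount P 0 = 0 := by
  simp [upCount]

theorem upCount_succ (P : BinPath) (k : ℕ) :
    upCount P (k + 1) = upCount P k + if P.getD k true then 1 else 0 := by
  rw [upCount, upCount, Finset.sum_range_succ]

theorem upCount_le_succ (P : BinPath) (k : ℕ) : upCount P k ≤ upCount P (k + 1) := by
  rw [upCount_succ]; omega

theorem upCount_succ_le (P : BinPath) (k : ℕ) : upCount P (k + 1) ≤ upCount P k + 1 := by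
  rw [upCount_succ]; split <;> omega

theorem ht_eq_upCount (P : BinPath) (k : ℕ) (hk : k ≤ P.length) :
    ht P k = 2 * (upCount P k : ℤ) - k := by
  induction k with
  | zero => simp [ht, upCount_zero]
  | succ k ih =>
    have h := ih (by omega)
    have hlt : k < P.length := by omega
    have hstep : ht P (k + 1) = ht P k + if P.getD k true then 1 else -1 := by
      rw [ht, ht, List.take_add_one, List.getElem?_eq_getElem hlt, List.getD_eq_getElem _ _ hlt,
        List.map_append, List.sum_append]
      simp only [Option.toList_some, List.map_cons, List.map_nil, List.sum_singleton]
    rw [hstep, h, upCount_succ]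
    split <;> push_cast <;> ring

theorem ht_of_length_le (P : BinPath) (k : ℕ) (hk : P.length ≤ k) :
    ht P k = ht P P.length := by
  simp [ht, List.take_of_length_le hk]

theorem pathLe_iff (P Q : BinPath) :
    pathLe P Q ↔ P.length = Q.length ∧ ∀ k ≤ P.length, upCount P k ≤ upCount Q k := by
  refine and_congr_right fun hl => ⟨fun h k hk => ?_, fun h k => ?_⟩
  · have := h k
    rw [ht_eq_upCount P k hk, ht_eq_upCount Q k (hl ▸ hk)] at this
    omega
  · rcases le_total k P.length with hk | hk
    · rw [ht_eq_upCount P k hk, ht_eq_upCount Q k (hl ▸ hk)]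
      have := h k hk
      omega
    · rw [ht_of_length_le P k hk, ht_of_length_le Q k (hl ▸ hk), ht_eq_upCount P _ le_rfl,
        ht_eq_upCount Q _ le_rfl, ← hl]
      have := h _ le_rfl
      omega

theorem eq_of_upCount_eq {P Q : BinPath} (hl : P.length = Q.length)
    (h : ∀ k ≤ P.length, upCount P k = upCount Q k) : P = Q := by
  refine List.ext_getElem hl fun i h₁ h₂ => ?_
  have hs := h (i + 1) h₁
  rw [upCount_succ, upCount_succ, h i h₁.le, List.getD_eq_getElem _ _ h₁,
    List.getD_eq_getElem _ _ h₂] at hs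
  cases hP : P[i] <;> cases hQ : Q[i] <;> simp_all

theorem pathLe_refl (P : BinPath) : pathLe P P := ⟨rfl, fun _ => le_rfl⟩

theorem pathLe_trans {P Q R : BinPath} (h : pathLe P Q) (h' : pathLe Q R) : pathLe P R :=
  ⟨h.1.trans h'.1, fun k => (h.2 k).trans (h'.2 k)⟩

theorem pathLe_antisymm {P Q : BinPath} (h : pathLe P Q) (h' : pathLe Q P) : P = Q := by
  rw [pathLe_iff] at h h'
  exact eq_of_upCount_eq h.1 fun k hk => le_antisymm (h.2 k hk) (h'.2 k (h.1 ▸ hk))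

theorem upCount_le (P : BinPath) (k : ℕ) : upCount P k ≤ k := by
  induction k with
  | zero => simp [upCount_zero]
  | succ k ih => have := upCount_succ_le P k; omega

theorem upCount_maxPath (n k : ℕ) : upCount (maxPath n) k = k := by
  induction k with
  | zero => simp [upCount_zero]
  | succ k ih =>
    have h : (maxPath n).getD k true = true := by
      rcases lt_or_ge k n with h | h <;> simp [maxPath, h]
    rw [upCount_succ, ih, h, if_pos rfl]

theorem length_maxPath (n : ℕ) : (maxPath n).length = n := by simp [maxPath]

theorem pathLe_maxPath (P : BinPath) : pathLe P (maxPath P.length) := by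
  rw [pathLe_iff]
  exact ⟨(length_maxPath _).symm, fun k _ => by rw [upCount_maxPath]; exact upCount_le P k⟩

theorem length_fill (P : BinPath) : (fill P).length = P.length := by simp [fill]

theorem getD_fill (P : BinPath) (k : ℕ) (hk : k < P.length) :
    (fill P).getD k true =
      if P.getD k true then P.getD (k - 1) true else P.getD (k + 1) true := by
  simp [fill, hk]

theorem upCount_fill (P : BinPath) (k : ℕ) (hk : k < P.length) :
    upCount (fill P) (k + 1) = min (upCount P k + 1) (upCount P (k + 2)) := by
  induction k with
  | zero =>
    rw [upCount_succ, upCount_succ, upCount_succ, upCount_zero, upCount_zero, getD_fill P 0 hk]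
    cases h₀ : P.getD 0 true <;> cases h₁ : P.getD 1 true <;> simp_all
  | succ k ih =>
    rw [upCount_succ, ih (by omega), getD_fill P _ hk, upCount_succ P (k + 2),
      upCount_succ P (k + 1), upCount_succ P k]
    simp only [Nat.add_sub_cancel]
    cases P.getD k true <;> cases P.getD (k + 1) true <;> cases P.getD (k + 2) true <;>
      simp

theorem upCount_add_two_mono {P Q : BinPath} (h : pathLe P Q) (k : ℕ) (hk : k < P.length) :
    upCount P (k + 2) ≤ upCount Q (k + 2) := by
  rw [pathLe_iff] at h
  rcases Nat.lt_or_ge (k + 1) P.length with hlt | hge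
  · exact h.2 _ hlt
  · have h₁ := h.2 (k + 1) hk
    have hP : Q.length ≤ k + 1 := h.1 ▸ hge
    rw [upCount_succ P (k + 1), upCount_succ Q (k + 1), List.getD_eq_default _ _ hge,
      List.getD_eq_default _ _ hP]
    omega

theorem fill_mono {P Q : BinPath} (h : pathLe P Q) : pathLe (fill P) (fill Q) := by
  rw [pathLe_iff, length_fill, length_fill]
  refine ⟨h.1, fun k hk => ?_⟩
  cases k with
  | zero => simp [upCount_zero]
  | succ k =>
    rw [upCount_fill P k hk, upCount_fill Q k (h.1 ▸ hk)]
    have h₁ := upCount_add_two_mono h k hk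
    have h₂ := ((pathLe_iff _ _).1 h).2 k (by omega)
    omega

theorem length_iterate_fill (P : BinPath) (k : ℕ) : (fill^[k] P).length = P.length := by
  induction k with
  | zero => rfl
  | succ k ih => rw [Function.iterate_succ_apply', length_fill, ih]

theorem iterate_fill_mono {P Q : BinPath} (h : pathLe P Q) (k : ℕ) :
    pathLe (fill^[k] P) (fill^[k] Q) := by
  induction k with
  | zero => exact h
  | succ k ih => rw [Function.iterate_succ_apply', Function.iterate_succ_apply']; exact fill_mono ih

theorem iterate_fill_succ_eq_maxPath {P R : BinPath} (hR : pathLe R (fill P)) {k : ℕ}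
    (h : fill^[k] R = maxPath P.length) : fill^[k + 1] P = maxPath P.length := by
  have h₁ := iterate_fill_mono hR k
  rw [h, ← Function.iterate_succ_apply] at h₁
  have h₂ := pathLe_maxPath (fill^[k + 1] P)
  rw [length_iterate_fill] at h₂
  exact pathLe_antisymm h₂ h₁

/-- The path of length `n` whose upstep counts are prescribed by `h`. -/
def pathOfCount (n : ℕ) (h : ℕ → ℕ) : BinPath :=
  List.ofFn fun i : Fin n => decide (h i < h (i + 1))

theorem length_pathOfCount (n : ℕ) (h : ℕ → ℕ) : (pathOfCount n h).length = n := by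
  simp [pathOfCount]

theorem upCount_pathOfCount {n : ℕ} {h : ℕ → ℕ} (h0 : h 0 = 0)
    (hs : ∀ k < n, h k ≤ h (k + 1) ∧ h (k + 1) ≤ h k + 1) (k : ℕ) (hk : k ≤ n) :
    upCount (pathOfCount n h) k = h k := by
  induction k with
  | zero => rw [upCount_zero, h0]
  | succ k ih =>
    have hlt : k < n := by omega
    have hg : (pathOfCount n h).getD k true = decide (h k < h (k + 1)) := by
      simp [pathOfCount, hlt]
    have := hs k hlt
    rw [upCount_succ, ih hlt.le, hg]
    simp only [decide_eq_true_eq]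
    split <;> omega

theorem finite_interval (P Q : BinPath) : {R : BinPath | pathLe P R ∧ pathLe R Q}.Finite :=
  (List.finite_length_eq Bool P.length).subset fun _ h => h.1.1.symm

/-- The interval `[P, Q]` as a finset. -/
noncomputable def pathIcc (P Q : BinPath) : Finset BinPath := (finite_interval P Q).toFinset

theorem mem_pathIcc {P Q R : BinPath} : R ∈ pathIcc P Q ↔ pathLe P R ∧ pathLe R Q := by
  simp [pathIcc]

theorem finsum_pathIcc (P Q : BinPath) (f : BinPath → ℤ) :
    (∑ᶠ (R : BinPath) (_ : pathLe P R ∧ pathLe R Q), f R) = ∑ R ∈ pathIcc P Q, f R :=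
  finsum_mem_eq_finite_toFinset_sum f (finite_interval P Q)

/-- The sum of the upstep counts at all points of `P`. -/
def upArea (P : BinPath) : ℕ := ∑ i ∈ Finset.range P.length, upCount P (i + 1)

/-- The sign of a path according to the parity of `upArea`. -/
def pathSign (P : BinPath) : ℤ := (-1) ^ upArea P

theorem pathSign_mul_self (P : BinPath) : pathSign P * pathSign P = 1 := by
  rw [pathSign, ← mul_pow]; simp

theorem upArea_mono {P Q : BinPath} (h : pathLe P Q) : upArea P ≤ upArea Q := by
  rw [pathLe_iff] at h
  rw [upArea, upArea, ← h.1]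
  exact Finset.sum_le_sum fun i hi => h.2 _ (Finset.mem_range.1 hi)

theorem lpq_eq {P Q : BinPath} (h : pathLe P Q) : lpq P Q = upArea Q - upArea P := by
  have hA := upArea_mono h
  have hs : ∑ i ∈ Finset.range P.length, (ht Q (i + 1) - ht P (i + 1)) =
      2 * ((upArea Q : ℤ) - upArea P) := by
    rw [upArea, upArea, ← h.1]
    push_cast
    rw [← Finset.sum_sub_distrib, Finset.mul_sum]
    refine Finset.sum_congr rfl fun i hi => ?_
    have hi' := Finset.mem_range.1 hi
    rw [ht_eq_upCount P _ hi', ht_eq_upCount Q _ (h.1 ▸ hi')]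
    push_cast
    ring
  rw [lpq, hs]
  omega

theorem neg_one_pow_lpq {P Q : BinPath} (h : pathLe P Q) :
    (-1 : ℤ) ^ lpq P Q = pathSign P * pathSign Q := by
  obtain ⟨c, hc⟩ := Nat.exists_eq_add_of_le (upArea_mono h)
  have h₁ := pathSign_mul_self P
  rw [lpq_eq h]
  simp only [pathSign] at *
  rw [hc, pow_add, ← mul_assoc, h₁, Nat.add_sub_cancel_left, one_mul]

/-- If `Q < R`, then some valley of `Q` lies strictly below `R`. -/
theorem exists_valley_below {Q R : BinPath} (h : pathLt Q R) :
    ∃ w < Q.length, upCount Q (w + 1) = upCount Q w ∧ upCount Q (w + 2) = upCount Q w + 1 ∧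
      upCount Q w + 1 ≤ upCount R (w + 1) := by
  have hle := (pathLe_iff _ _).1 h.1
  let s := (Finset.range (Q.length + 1)).filter fun k => upCount Q k < upCount R k
  have hs : s.Nonempty := by
    by_contra hne
    refine h.2 (eq_of_upCount_eq hle.1 fun k hk => le_antisymm (hle.2 k hk) ?_)
    by_contra hlt
    exact hne ⟨k, by simp [s]; omega⟩
  obtain ⟨v, hv, hmin⟩ := s.exists_min_image (fun k => 2 * (upCount Q k : ℤ) - k) hs
  have hv' : v < Q.length + 1 ∧ upCount Q v < upCount R v := by simpa [s] using hv
  obtain ⟨hvn, hvlt⟩ := hv'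
  cases v with
  | zero => simp [upCount_zero] at hvlt
  | succ w =>
    have hmem : ∀ k ≤ Q.length, upCount Q k < upCount R k →
        2 * (upCount Q (w + 1) : ℤ) - (w + 1 : ℕ) ≤ 2 * (upCount Q k : ℤ) - k := by
      intro k hk hlt
      exact hmin k (by simp [s]; omega)
    have h₁ := upCount_le_succ Q w
    have h₂ := upCount_succ_le Q w
    have h₃ : upCount Q (w + 1) ≤ upCount Q (w + 2) := upCount_le_succ Q (w + 1)
    have h₄ : upCount Q (w + 2) ≤ upCount Q (w + 1) + 1 := upCount_succ_le Q (w + 1)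
    have h₅ := upCount_succ_le R w
    have h₆ : upCount R (w + 1) ≤ upCount R (w + 2) := upCount_le_succ R (w + 1)
    have hw : upCount Q (w + 1) = upCount Q w := by
      by_contra hne
      have := hmem w (by omega) (by omega)
      push_cast at this
      omega
    refine ⟨w, by omega, hw, ?_, by omega⟩
    by_contra hne
    rcases Nat.lt_or_ge (w + 1) Q.length with hlt | hge
    · have := hmem (w + 2) (by omega) (by omega)
      push_cast at this
      omega
    · have hlast := upCount_succ Q (w + 1)
      rw [List.getD_eq_default _ _ hge, if_pos rfl] at hlast
      exact hne (hlast.trans (by rw [hw]))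

/-- Reflect the point `v` of `S` between the upstep counts `q` and `q + 1`. -/
def toggleAt (v q : ℕ) (S : BinPath) : BinPath :=
  pathOfCount S.length fun k => if k = v then 2 * q + 1 - upCount S v else upCount S k

theorem length_toggleAt (v q : ℕ) (S : BinPath) : (toggleAt v q S).length = S.length :=
  length_pathOfCount _ _

section Toggle

variable {Q S : BinPath} {w : ℕ}

theorem upCount_near_valley (hw : w < Q.length) (h₁ : upCount Q (w + 1) = upCount Q w)
    (h₂ : upCount Q (w + 2) = upCount Q w + 1) (hQS : pathLe Q S) (hS : pathLe S (fill Q)) :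
    upCount S w = upCount Q w ∧ upCount Q w ≤ upCount S (w + 1) ∧
      upCount S (w + 1) ≤ upCount Q w + 1 ∧
      (w + 2 ≤ Q.length → upCount S (w + 2) = upCount Q w + 1) := by
  rw [pathLe_iff] at hQS hS
  have hl := hQS.1
  have hw' := hS.2 w (by omega)
  have a₀ := hQS.2 w (by omega)
  have a₁ := hQS.2 (w + 1) (by omega)
  have b₁ := hS.2 (w + 1) (by omega)
  rw [upCount_fill Q w hw] at b₁
  refine ⟨le_antisymm ?_ a₀, by omega, by omega, fun hn => ?_⟩
  · cases w with
    | zero => simp [upCount_zero]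
    | succ u =>
      rw [upCount_fill Q u (by omega)] at hw'
      exact (hw'.trans (min_le_right _ _)).trans h₁.le
  · have a₂ := hQS.2 (w + 2) hn
    have b₂ := hS.2 (w + 2) (by omega)
    rw [upCount_fill Q (w + 1) (by omega)] at b₂
    omega

theorem upCount_toggleAt (hw : w < Q.length) (h₁ : upCount Q (w + 1) = upCount Q w)
    (h₂ : upCount Q (w + 2) = upCount Q w + 1) (hQS : pathLe Q S) (hS : pathLe S (fill Q))
    (k : ℕ) (hk : k ≤ S.length) :
    upCount (toggleAt (w + 1) (upCount Q w) S) k =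
      if k = w + 1 then 2 * upCount Q w + 1 - upCount S (w + 1) else upCount S k := by
  obtain ⟨c₀, c₁, c₂, c₃⟩ := upCount_near_valley hw h₁ h₂ hQS hS
  have hl := hQS.1
  refine upCount_pathOfCount (by simp [upCount_zero]) (fun j hj => ?_) k hk
  have d₁ := upCount_le_succ S j
  have d₂ := upCount_succ_le S j
  by_cases e₁ : j = w + 1
  · subst e₁
    have hnext : upCount S (w + 1 + 1) = upCount Q w + 1 := c₃ (by omega)
    simp
    omega
  · by_cases e₂ : j = w
    · subst e₂
      simp
      omega
    · simp [e₁, e₂, d₁, d₂]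

theorem pathLe_toggleAt (hw : w < Q.length) (h₁ : upCount Q (w + 1) = upCount Q w)
    (h₂ : upCount Q (w + 2) = upCount Q w + 1) (hQS : pathLe Q S) (hS : pathLe S (fill Q)) :
    pathLe Q (toggleAt (w + 1) (upCount Q w) S) := by
  have c := upCount_near_valley hw h₁ h₂ hQS hS
  rw [pathLe_iff, length_toggleAt]
  refine ⟨hQS.1, fun k hk => ?_⟩
  rw [upCount_toggleAt hw h₁ h₂ hQS hS k (hQS.1 ▸ hk)]
  split
  · subst k; omega
  · exact ((pathLe_iff _ _).1 hQS).2 k hk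

theorem toggleAt_pathLe {R : BinPath} (hw : w < Q.length)
    (h₁ : upCount Q (w + 1) = upCount Q w)
    (h₂ : upCount Q (w + 2) = upCount Q w + 1) (hQS : pathLe Q S) (hS : pathLe S (fill Q))
    (hR : upCount Q w + 1 ≤ upCount R (w + 1)) (hSR : pathLe S R) :
    pathLe (toggleAt (w + 1) (upCount Q w) S) R := by
  have c := upCount_near_valley hw h₁ h₂ hQS hS
  rw [pathLe_iff, length_toggleAt]
  refine ⟨hSR.1, fun k hk => ?_⟩
  rw [upCount_toggleAt hw h₁ h₂ hQS hS k hk]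
  split
  · subst k; omega
  · exact ((pathLe_iff _ _).1 hSR).2 k hk

theorem toggleAt_pathLe_fill (hw : w < Q.length) (h₁ : upCount Q (w + 1) = upCount Q w)
    (h₂ : upCount Q (w + 2) = upCount Q w + 1) (hQS : pathLe Q S) (hS : pathLe S (fill Q)) :
    pathLe (toggleAt (w + 1) (upCount Q w) S) (fill Q) := by
  refine toggleAt_pathLe hw h₁ h₂ hQS hS ?_ hS
  rw [upCount_fill Q w hw]
  omega

theorem toggleAt_toggleAt (hw : w < Q.length) (h₁ : upCount Q (w + 1) = upCount Q w)
    (h₂ : upCount Q (w + 2) = upCount Q w + 1) (hQS : pathLe Q S) (hS : pathLe S (fill Q)) :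
    toggleAt (w + 1) (upCount Q w) (toggleAt (w + 1) (upCount Q w) S) = S := by
  have c := upCount_near_valley hw h₁ h₂ hQS hS
  have hl := hQS.1
  refine eq_of_upCount_eq (by simp only [length_toggleAt]) fun k hk => ?_
  simp only [length_toggleAt] at hk
  rw [upCount_toggleAt hw h₁ h₂ (pathLe_toggleAt hw h₁ h₂ hQS hS)
      (toggleAt_pathLe_fill hw h₁ h₂ hQS hS) k (by rwa [length_toggleAt]),
    upCount_toggleAt hw h₁ h₂ hQS hS k hk, upCount_toggleAt hw h₁ h₂ hQS hS (w + 1) (by omega)]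
  by_cases e : k = w + 1
  · subst e; simp; omega
  · simp [e]

theorem pathSign_toggleAt (hw : w < Q.length) (h₁ : upCount Q (w + 1) = upCount Q w)
    (h₂ : upCount Q (w + 2) = upCount Q w + 1) (hQS : pathLe Q S) (hS : pathLe S (fill Q)) :
    pathSign (toggleAt (w + 1) (upCount Q w) S) = -pathSign S := by
  have c := upCount_near_valley hw h₁ h₂ hQS hS
  have hwS : w ∈ Finset.range S.length := Finset.mem_range.2 (hQS.1 ▸ hw)
  have hA : upArea (toggleAt (w + 1) (upCount Q w) S) + upCount S (w + 1) =
      upArea S + (2 * upCount Q w + 1 - upCount S (w + 1)) := by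
    rw [upArea, upArea, length_toggleAt, ← Finset.add_sum_erase _ _ hwS,
      ← Finset.add_sum_erase (Finset.range S.length) (fun i => upCount S (i + 1)) hwS,
      upCount_toggleAt hw h₁ h₂ hQS hS (w + 1) (Finset.mem_range.1 hwS), if_pos rfl]
    have : ∑ i ∈ (Finset.range S.length).erase w,
        upCount (toggleAt (w + 1) (upCount Q w) S) (i + 1) =
        ∑ i ∈ (Finset.range S.length).erase w, upCount S (i + 1) := by
      refine Finset.sum_congr rfl fun i hi => ?_
      rw [Finset.mem_erase, Finset.mem_range] at hi
      rw [upCount_toggleAt hw h₁ h₂ hQS hS (i + 1) hi.2, if_neg (by omega)]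
    rw [this]
    ring
  have hp : upArea (toggleAt (w + 1) (upCount Q w) S) = upArea S + 1 ∨
      upArea S = upArea (toggleAt (w + 1) (upCount Q w) S) + 1 := by
    omega
  rcases hp with hp | hp <;> simp [pathSign, hp, pow_succ]

end Toggle

theorem pathSign_ne_zero (P : BinPath) : pathSign P ≠ 0 := by
  simp [pathSign]

open Classical in
theorem sum_pathSign_eq_zero {Q R : BinPath} (h : pathLt Q R) :
    ∑ S ∈ pathIcc Q R, (if pathLe S (fill Q) then pathSign Q * pathSign S else 0) = 0 := by
  obtain ⟨w, hw, h₁, h₂, hR⟩ := exists_valley_below h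
  rw [← Finset.sum_filter]
  have key : ∀ S ∈ (pathIcc Q R).filter fun S => pathLe S (fill Q),
      pathLe Q S ∧ pathLe S R ∧ pathLe S (fill Q) := by
    intro S hS
    rw [Finset.mem_filter, mem_pathIcc] at hS
    exact ⟨hS.1.1, hS.1.2, hS.2⟩
  refine Finset.sum_involution (fun S _ => toggleAt (w + 1) (upCount Q w) S)
    (fun S hS => ?_) (fun S hS _ he => ?_) (fun S hS => ?_) (fun S hS => ?_)
  · obtain ⟨a, b, c⟩ := key S hS
    rw [pathSign_toggleAt hw h₁ h₂ a c]
    ring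
  · obtain ⟨a, b, c⟩ := key S hS
    have hs := pathSign_toggleAt hw h₁ h₂ a c
    rw [he] at hs
    exact pathSign_ne_zero S (by linarith)
  · obtain ⟨a, b, c⟩ := key S hS
    rw [Finset.mem_filter, mem_pathIcc]
    exact ⟨⟨pathLe_toggleAt hw h₁ h₂ a c, toggleAt_pathLe hw h₁ h₂ a c hR b⟩,
      toggleAt_pathLe_fill hw h₁ h₂ a c⟩
  · obtain ⟨a, b, c⟩ := key S hS
    exact toggleAt_toggleAt hw h₁ h₂ a c

theorem pathLe_fill (P : BinPath) : pathLe P (fill P) := by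
  rw [pathLe_iff, length_fill]
  refine ⟨rfl, fun k hk => ?_⟩
  cases k with
  | zero => simp [upCount_zero]
  | succ k =>
    rw [upCount_fill P k hk]
    have := upCount_succ_le P k
    exact le_min this (upCount_le_succ P (k + 1))

theorem card_pathIcc_lt {Q R S : BinPath} (hQS : pathLe Q S) (h : pathLe S R) (hne : S ≠ R) :
    (pathIcc Q S).card < (pathIcc Q R).card := by
  refine Finset.card_lt_card ⟨fun T hT => ?_, fun hsub => hne ?_⟩
  · rw [mem_pathIcc] at *
    exact ⟨hT.1, pathLe_trans hT.2 h⟩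
  · have := hsub (mem_pathIcc.2 ⟨pathLe_trans hQS h, pathLe_refl R⟩)
    exact pathLe_antisymm h (mem_pathIcc.1 this).2

open Classical in
/-- The Möbius function is supported on small intervals, where it is given by the signs. -/
theorem mobius_eq {mu : BinPath → BinPath → ℤ} (hmu1 : ∀ Q : BinPath, mu Q Q = 1)
    (hmu2 : ∀ Q R : BinPath, pathLt Q R →
      (∑ᶠ (S : BinPath) (_ : pathLe Q S ∧ pathLe S R), mu Q S) = 0)
    {Q R : BinPath} (hQR : pathLe Q R) :
    mu Q R = if pathLe R (fill Q) then pathSign Q * pathSign R else 0 := by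
  induction hc : (pathIcc Q R).card using Nat.strong_induction_on generalizing R with
  | _ c ih =>
    by_cases hne : Q = R
    · subst hne
      rw [hmu1, if_pos (pathLe_fill Q), pathSign_mul_self]
    · have hlt : pathLt Q R := ⟨hQR, hne⟩
      have e₁ := hmu2 Q R hlt
      have e₂ := sum_pathSign_eq_zero hlt
      have hR : R ∈ pathIcc Q R := mem_pathIcc.2 ⟨hQR, pathLe_refl R⟩
      rw [finsum_pathIcc, ← Finset.add_sum_erase _ _ hR] at e₁
      rw [← Finset.add_sum_erase _ _ hR] at e₂
      have e₃ : ∑ S ∈ (pathIcc Q R).erase R, mu Q S = ∑ S ∈ (pathIcc Q R).erase R,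
          (if pathLe S (fill Q) then pathSign Q * pathSign S else 0) := by
        refine Finset.sum_congr rfl fun S hS => ?_
        rw [Finset.mem_erase, mem_pathIcc] at hS
        exact ih _ (hc ▸ card_pathIcc_lt hS.2.1 hS.2.2 hS.1) hS.2.1 rfl
      linarith

open Classical in
/-- The number of multichains of length `k` from `P` to the maximum with small intervals. -/
noncomputable def smallChainCount : ℕ → BinPath → ℕ
  | 0, P => if P = maxPath P.length then 1 else 0
  | k + 1, P => ∑ R ∈ pathIcc P (fill P), smallChainCount k R

theorem muPow_maxPath {mu : BinPath → BinPath → ℤ} (hmu1 : ∀ Q : BinPath, mu Q Q = 1)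
    (hmu2 : ∀ Q R : BinPath, pathLt Q R →
      (∑ᶠ (S : BinPath) (_ : pathLe Q S ∧ pathLe S R), mu Q S) = 0) (k : ℕ) (P : BinPath) :
    muPow mu k P (maxPath P.length) =
      pathSign P * pathSign (maxPath P.length) * smallChainCount k P := by
  classical
  induction k generalizing P with
  | zero =>
    by_cases h : P = maxPath P.length
    · have hs := pathSign_mul_self P
      simp only [muPow, Function.iterate_zero, id, deltaFun, smallChainCount, if_pos h]
      rw [← h, hs]
      simp
    · simp [muPow, deltaFun, smallChainCount, h]
  | succ k ih =>
    have hstep : muPow mu (k + 1) = conv mu (muPow mu k) := by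
      rw [muPow, Function.iterate_succ_apply', muPow]
    have hsub : pathIcc P (fill P) ⊆ pathIcc P (maxPath P.length) := by
      intro R hR
      rw [mem_pathIcc] at *
      exact ⟨hR.1, hR.1.1 ▸ pathLe_maxPath R⟩
    rw [hstep, conv, finsum_pathIcc, smallChainCount, Nat.cast_sum, Finset.mul_sum,
      ← Finset.sum_subset hsub]
    · refine Finset.sum_congr rfl fun R hR => ?_
      rw [mem_pathIcc] at hR
      have hk := ih R
      rw [← hR.1.1] at hk
      rw [mobius_eq hmu1 hmu2 hR.1, if_pos hR.2, hk]
      linear_combination (pathSign P * pathSign (maxPath P.length) * (smallChainCount k R : ℤ)) *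
        pathSign_mul_self R
    · intro R hR hR'
      rw [mem_pathIcc] at hR hR'
      rw [mobius_eq hmu1 hmu2 hR.1, if_neg fun h => hR' ⟨hR.1, h⟩, zero_mul]

theorem smallChainCount_eq_zero {k : ℕ} {P : BinPath} (h : fill^[k] P ≠ maxPath P.length) :
    smallChainCount k P = 0 := by
  induction k generalizing P with
  | zero => exact if_neg h
  | succ k ih =>
    rw [smallChainCount]
    refine Finset.sum_eq_zero fun R hR => ih fun hmax => h ?_
    rw [mem_pathIcc] at hR
    rw [← hR.1.1] at hmax
    exact iterate_fill_succ_eq_maxPath hR.2 hmax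

/-- Prepend a path to a sequence of paths. -/
def consPath (P : BinPath) (c : ℕ → BinPath) : ℕ → BinPath
  | 0 => P
  | i + 1 => c i

theorem consPath_injective (P : BinPath) : Function.Injective (consPath P) := fun _ _ h =>
  funext fun i => congrFun h (i + 1)

theorem exists_finset_smallChains (k : ℕ) (P : BinPath)
    (h : ∀ j < k, fill^[j] P ≠ maxPath P.length) :
    ∃ F : Finset (ℕ → BinPath), (∀ c, c ∈ F ↔
      c 0 = P ∧ (∀ i, k ≤ i → c i = maxPath P.length) ∧
        ∀ i < k, pathLt (c i) (c (i + 1)) ∧ pathLe (c (i + 1)) (fill (c i))) ∧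
      F.card = smallChainCount k P := by
  classical
  induction k generalizing P with
  | zero =>
    by_cases hP : P = maxPath P.length
    · refine ⟨{fun _ => maxPath P.length}, fun c => ?_, by simp [smallChainCount, ← hP]⟩
      rw [Finset.mem_singleton]
      constructor
      · rintro rfl
        exact ⟨hP.symm, fun _ _ => rfl, fun i hi => absurd hi (Nat.not_lt_zero i)⟩
      · rintro ⟨-, hc, -⟩
        exact funext fun i => hc i (Nat.zero_le i)
    · refine ⟨∅, fun c => ?_, by simp [smallChainCount, hP]⟩
      simp only [Finset.notMem_empty, false_iff]
      rintro ⟨h0, hc, -⟩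
      exact hP (h0.symm.trans (hc 0 le_rfl))
  | succ k ih =>
    have hex : ∀ R ∈ (pathIcc P (fill P)), ∀ j < k, fill^[j] R ≠ maxPath R.length := by
      intro R hR j hj hR'
      rw [mem_pathIcc] at hR
      rw [← hR.1.1] at hR'
      exact h (j + 1) (by omega) (iterate_fill_succ_eq_maxPath hR.2 hR')
    choose! F hF hcard using fun R (hR : R ∈ pathIcc P (fill P)) => ih R (hex R hR)
    have hP : P ∈ pathIcc P (fill P) := mem_pathIcc.2 ⟨pathLe_refl P, pathLe_fill P⟩
    refine ⟨((pathIcc P (fill P)).erase P).biUnion fun R => (F R).image (consPath P),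
      fun c => ?_, ?_⟩
    · simp only [Finset.mem_biUnion, Finset.mem_image, Finset.mem_erase]
      constructor
      · rintro ⟨R, ⟨hne, hR⟩, c, hc, rfl⟩
        obtain ⟨c0, cmax, cs⟩ := (hF R hR c).1 hc
        have hR' := mem_pathIcc.1 hR
        refine ⟨rfl, fun i hi => ?_, fun i hi => ?_⟩
        · obtain ⟨i, rfl⟩ : ∃ j, i = j + 1 := ⟨i - 1, by omega⟩
          rw [hR'.1.1]
          exact cmax i (by omega)
        · cases i with
          | zero =>
            simp only [consPath, c0]
            exact ⟨⟨hR'.1, hne.symm⟩, hR'.2⟩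
          | succ i => exact cs i (by omega)
      · rintro ⟨c0, cmax, cs⟩
        have c1 := cs 0 (by omega)
        rw [c0] at c1
        have hR : c 1 ∈ pathIcc P (fill P) := mem_pathIcc.2 ⟨c1.1.1, c1.2⟩
        refine ⟨c 1, ⟨c1.1.2.symm, hR⟩, fun i => c (i + 1), (hF _ hR _).2 ⟨rfl, ?_, ?_⟩, ?_⟩
        · intro i hi
          rw [← c1.1.1.1]
          exact cmax (i + 1) (by omega)
        · exact fun i hi => cs (i + 1) (by omega)
        · funext i
          cases i with
          | zero => exact c0.symm
          | succ i => rfl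
    · rw [Finset.card_biUnion, smallChainCount, ← Finset.add_sum_erase _ _ hP,
        smallChainCount_eq_zero (h k (by omega)), zero_add]
      · refine Finset.sum_congr rfl fun R hR => ?_
        rw [Finset.card_image_of_injective _ (consPath_injective P),
          hcard R (Finset.mem_of_mem_erase hR)]
      · intro R hR R' hR' hne
        rw [Function.onFun, Finset.disjoint_left]
        intro c hc hc'
        obtain ⟨d, hd, rfl⟩ := Finset.mem_image.1 hc
        obtain ⟨d', hd', he⟩ := Finset.mem_image.1 hc'
        have := consPath_injective P he
        subst this
        exact hne (((hF R (Finset.mem_of_mem_erase hR) _).1 hd).1.symm.trans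
          ((hF R' (Finset.mem_of_mem_erase hR') _).1 hd').1)

theorem fPath_eq_smallChainCount (P : BinPath) : fPath P = smallChainCount (degree P) P := by
  obtain ⟨F, hF, hcard⟩ := exists_finset_smallChains (degree P) P
    fun j hj => Nat.notMem_of_lt_sInf hj
  rw [← hcard, ← Set.ncard_coe_finset, fPath]
  congr 1
  ext c
  exact (hF c).symm

/-- Let `μ` be the Möbius function of the lattice of binary
paths (characterized by its defining relations).  For every binary path `P` and
`k : ℕ`: if `k < δ(P)` then `μ^k(P, 1_{|P|}) = 0`, and if `k = δ(P)` then
`μ^k(P, 1_{|P|}) = (−1)^{l(P,1_{|P|})}·f(P)`. -/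
theorem statement8 (P : BinPath) (k : ℕ) (mu : BinPath → BinPath → ℤ)
    (hmu1 : ∀ Q : BinPath, mu Q Q = 1)
    (hmu2 : ∀ Q R : BinPath, pathLt Q R →
      (∑ᶠ (S : BinPath) (_ : pathLe Q S ∧ pathLe S R), mu Q S) = 0)
    (hmu3 : ∀ Q R : BinPath, ¬ pathLe Q R → mu Q R = 0) :
    (k < degree P → muPow mu k P (maxPath P.length) = 0) ∧
    (k = degree P →
      muPow mu k P (maxPath P.length)
        = (-1) ^ lpq P (maxPath P.length) * (fPath P : ℤ)) := by
  refine ⟨fun hk => ?_, fun hk => ?_⟩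
  · rw [muPow_maxPath hmu1 hmu2, smallChainCount_eq_zero (Nat.notMem_of_lt_sInf hk)]
    simp
  · rw [muPow_maxPath hmu1 hmu2, fPath_eq_smallChainCount, neg_one_pow_lpq (pathLe_maxPath P), hk]
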